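/- arXiv:1612.01765 — 2 statements merged into one kernel-verified Lean document; each statement's English description precedes it below -/
import Mathlib

section
/- Let k, m, n be positive integers, let A_{ij} (for i = 1,...,k and j = 1,...,m) be n×n matrices with nonnegative real entries, and let α₁,...,αₘ be positive real numbers with α₁ + ⋯ + αₘ = 1. Then ρ((A₁₁^(α₁) ∘ ⋯ ∘ A₁ₘ^(αₘ)) ⋯ (A_{k1}^(α₁) ∘ ⋯ ∘ A_{km}^(αₘ))) ≤ ρ(A₁₁A₂₁⋯A_{k1})^{α₁} ⋯ ρ(A₁ₘA₂ₘ⋯A_{km})^{αₘ}. -/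
open scoped ENNReal NNReal BigOperators

/-- Spectral radius of a real matrix: the spectral radius of the corresponding
complex matrix (equivalently, the maximum modulus of its complex eigenvalues). -/
noncomputable def specRad {n : ℕ} (A : Matrix (Fin n) (Fin n) ℝ) : ℝ≥0∞ :=
  spectralRadius ℂ (A.map (fun x => (x : ℂ)))

/-- Operator norm of a real `n × n` matrix induced by the Euclidean norm on `ℝⁿ`. -/
noncomputable def opNorm {n : ℕ} (A : Matrix (Fin n) (Fin n) ℝ) : ℝ :=
  ‖LinearMap.toContinuousLinearMap (Matrix.toEuclideanLin A)‖

/-- The weighted Hadamard (Schur) geometric mean `A₁^(α₁) ∘ ⋯ ∘ Aₘ^(αₘ)`. -/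
noncomputable def hadWMean {n m : ℕ} (α : Fin m → ℝ)
    (A : Fin m → Matrix (Fin n) (Fin n) ℝ) : Matrix (Fin n) (Fin n) ℝ :=
  Matrix.of fun x y => ∏ j, (A j x y) ^ (α j)

/-- The ordered product `A 0 * A 1 * ⋯ * A (k-1)`. -/
def matListProd {n k : ℕ} (A : Fin k → Matrix (Fin n) (Fin n) ℝ) :
    Matrix (Fin n) (Fin n) ℝ :=
  (List.ofFn A).prod

/-- The set `Σ^k` of all products of `k` elements of `S`. -/
def setPow {n : ℕ} (S : Set (Matrix (Fin n) (Fin n) ℝ)) (k : ℕ) :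
    Set (Matrix (Fin n) (Fin n) ℝ) :=
  {B | ∃ A : Fin k → Matrix (Fin n) (Fin n) ℝ, (∀ i, A i ∈ S) ∧ B = matListProd A}

/-- The set `Ψ₁ Ψ₂ ⋯ Ψₘ` of products with the `j`-th factor from `Ψ j`. -/
def setProd {n m : ℕ} (Ψ : Fin m → Set (Matrix (Fin n) (Fin n) ℝ)) :
    Set (Matrix (Fin n) (Fin n) ℝ) :=
  {B | ∃ A : Fin m → Matrix (Fin n) (Fin n) ℝ, (∀ j, A j ∈ Ψ j) ∧ B = matListProd A}

/-- The weighted Hadamard geometric mean `Ψ₁^(α₁) ∘ ⋯ ∘ Ψₘ^(αₘ)` of sets. -/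
noncomputable def setHadWMean {n m : ℕ} (α : Fin m → ℝ)
    (Ψ : Fin m → Set (Matrix (Fin n) (Fin n) ℝ)) :
    Set (Matrix (Fin n) (Fin n) ℝ) :=
  {B | ∃ A : Fin m → Matrix (Fin n) (Fin n) ℝ, (∀ j, A j ∈ Ψ j) ∧ B = hadWMean α A}

/-- The generalized spectral radius `ρ(Σ) = limsup_{k→∞} (sup_{A ∈ Σ^k} ρ(A))^{1/k}`. -/
noncomputable def genSpecRad {n : ℕ} (S : Set (Matrix (Fin n) (Fin n) ℝ)) : ℝ≥0∞ :=
  Filter.atTop.limsup fun k : ℕ => (⨆ B ∈ setPow S k, specRad B) ^ (1 / (k : ℝ))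

/-- The joint spectral radius `ρ̂(Σ) = limsup_{k→∞} (sup_{A ∈ Σ^k} ‖A‖)^{1/k}`. -/
noncomputable def jointSpecRad {n : ℕ} (S : Set (Matrix (Fin n) (Fin n) ℝ)) : ℝ≥0∞ :=
  Filter.atTop.limsup fun k : ℕ =>
    (⨆ B ∈ setPow S k, ENNReal.ofReal (opNorm B)) ^ (1 / (k : ℝ))

/-- Generalized Hölder inequality for finite sums. -/
theorem NNReal.sum_prod_rpow_le_prod_sum_rpow {ι κ : Type*} [Fintype ι] (s : Finset κ)
    (f : κ → ι → ℝ≥0) {p : κ → ℝ} (hp : ∑ j ∈ s, p j = 1) (h0 : ∀ j ∈ s, 0 ≤ p j) :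
    ∑ x, ∏ j ∈ s, f j x ^ p j ≤ ∏ j ∈ s, (∑ x, f j x) ^ p j := by
  let _ : MeasurableSpace ι := ⊤
  have h := ENNReal.lintegral_prod_norm_pow_le (μ := MeasureTheory.Measure.count) s
    (f := fun j x => (f j x : ℝ≥0∞)) (fun j _ => measurable_from_top.aemeasurable) hp h0
  simp only [MeasureTheory.lintegral_count, tsum_fintype] at h
  rw [← ENNReal.coe_le_coe]
  push_cast
  convert h using 1
  · refine Finset.sum_congr rfl fun x _ => Finset.prod_congr rfl fun j hj => ?_
    exact (ENNReal.coe_rpow_of_nonneg _ (h0 j hj))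
  · refine Finset.prod_congr rfl fun j hj => ?_
    rw [ENNReal.coe_rpow_of_nonneg _ (h0 j hj)]
    push_cast
    rfl

namespace Matrix

/-- The weighted Hadamard geometric mean of matrices with entries in `ℝ≥0`. -/
noncomputable def hadamardWeightedMean {ι κ l : Type*} [Fintype κ] (α : κ → ℝ)
    (A : κ → Matrix ι l ℝ≥0) : Matrix ι l ℝ≥0 :=
  of fun x y => ∏ j, A j x y ^ α j

theorem one_entrywise_le_hadamardWeightedMean_one {ι κ : Type*} [Fintype κ] [DecidableEq ι]
    {α : κ → ℝ} (x y : ι) :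
    (1 : Matrix ι ι ℝ≥0) x y ≤ hadamardWeightedMean α (fun _ => 1) x y := by
  by_cases h : x = y
  · subst h
    simp [hadamardWeightedMean]
  · simp [h]

section NNRealMatrix

variable {ι κ : Type*} [Fintype ι] [Fintype κ] {α : κ → ℝ}

theorem mul_entrywise_le_mul {A A' B B' : Matrix ι ι ℝ≥0} (hA : ∀ x y, A x y ≤ A' x y)
    (hB : ∀ x y, B x y ≤ B' x y) (x y : ι) : (A * B) x y ≤ (A' * B') x y :=
  Finset.sum_le_sum fun z _ => mul_le_mul' (hA x z) (hB z y)

theorem hadamardWeightedMean_mul_le (h0 : ∀ j, 0 ≤ α j) (h1 : ∑ j, α j = 1)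
    (A B : κ → Matrix ι ι ℝ≥0) (x y : ι) :
    (hadamardWeightedMean α A * hadamardWeightedMean α B) x y ≤
      hadamardWeightedMean α (fun j => A j * B j) x y := by
  simp only [hadamardWeightedMean, mul_apply, of_apply, ← Finset.prod_mul_distrib,
    ← NNReal.mul_rpow]
  exact NNReal.sum_prod_rpow_le_prod_sum_rpow _ (fun j z => A j x z * B j z y) h1
    fun j _ => h0 j

theorem list_prod_hadamardWeightedMean_le [DecidableEq ι] (h0 : ∀ j, 0 ≤ α j)
    (h1 : ∑ j, α j = 1) (L : List (κ → Matrix ι ι ℝ≥0)) (x y : ι) :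
    (L.map (hadamardWeightedMean α)).prod x y ≤
      hadamardWeightedMean α (fun j => (L.map (· j)).prod) x y := by
  induction L generalizing x y with
  | nil => exact one_entrywise_le_hadamardWeightedMean_one x y
  | cons A L ih =>
    simp only [List.map_cons, List.prod_cons]
    exact (mul_entrywise_le_mul (fun _ _ => le_rfl) ih x y).trans
      (hadamardWeightedMean_mul_le h0 h1 _ _ x y)

theorem pow_entrywise_le_pow [DecidableEq ι] {A B : Matrix ι ι ℝ≥0}
    (h : ∀ x y, A x y ≤ B x y) (N : ℕ) (x y : ι) : (A ^ N) x y ≤ (B ^ N) x y := by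
  induction N generalizing x y with
  | zero => simp
  | succ N ih =>
    rw [pow_succ, pow_succ]
    exact mul_entrywise_le_mul ih h x y

theorem hadamardWeightedMean_pow_le [DecidableEq ι] (h0 : ∀ j, 0 ≤ α j)
    (h1 : ∑ j, α j = 1) (A : κ → Matrix ι ι ℝ≥0) (N : ℕ) (x y : ι) :
    (hadamardWeightedMean α A ^ N) x y ≤ hadamardWeightedMean α (fun j => A j ^ N) x y := by
  simpa using list_prod_hadamardWeightedMean_le h0 h1 (List.replicate N A) x y

/-- The maximal row sum of a matrix with entries in `ℝ≥0`. -/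
noncomputable def maxRowSum (A : Matrix ι ι ℝ≥0) : ℝ≥0 :=
  Finset.univ.sup fun x => ∑ y, A x y

theorem maxRowSum_mono {A B : Matrix ι ι ℝ≥0} (h : ∀ x y, A x y ≤ B x y) :
    maxRowSum A ≤ maxRowSum B :=
  Finset.sup_mono_fun fun x _ => Finset.sum_le_sum fun y _ => h x y

theorem maxRowSum_hadamardWeightedMean_le (h0 : ∀ j, 0 ≤ α j) (h1 : ∑ j, α j = 1)
    (A : κ → Matrix ι ι ℝ≥0) :
    maxRowSum (hadamardWeightedMean α A) ≤ ∏ j, maxRowSum (A j) ^ α j := by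
  refine Finset.sup_le fun x _ => ?_
  refine (NNReal.sum_prod_rpow_le_prod_sum_rpow _ (fun j y => A j x y) h1
    fun j _ => h0 j).trans ?_
  exact Finset.prod_le_prod' fun j _ => NNReal.rpow_le_rpow
    (Finset.le_sup (f := fun x => ∑ y, A j x y) (Finset.mem_univ x)) (h0 j)

/-- The inclusion of matrices with entries in `ℝ≥0` into complex matrices. -/
noncomputable def nnrealToComplex [DecidableEq ι] : Matrix ι ι ℝ≥0 →+* Matrix ι ι ℂ :=
  (Complex.ofRealHom.comp NNReal.toRealHom).mapMatrix

section Norm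

open scoped Matrix.Norms.Operator

variable [DecidableEq ι]

theorem nnnorm_nnrealToComplex (A : Matrix ι ι ℝ≥0) :
    ‖nnrealToComplex A‖₊ = maxRowSum A := by
  simp [nnrealToComplex, linfty_opNNNorm_def, maxRowSum]

theorem tendsto_maxRowSum_pow (A : Matrix ι ι ℝ≥0) :
    Filter.Tendsto (fun N : ℕ => (maxRowSum (A ^ N) : ℝ≥0∞) ^ (1 / N : ℝ)) Filter.atTop
      (nhds (spectralRadius ℂ (nnrealToComplex A))) := by
  have : CompleteSpace (Matrix ι ι ℂ) := FiniteDimensional.complete ℂ _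
  simpa [← map_pow, nnnorm_nnrealToComplex] using
    spectrum.pow_nnnorm_pow_one_div_tendsto_nhds_spectralRadius (nnrealToComplex A)

theorem spectralRadius_ne_top [Nonempty ι] (A : Matrix ι ι ℂ) : spectralRadius ℂ A ≠ ⊤ := by
  have : CompleteSpace (Matrix ι ι ℂ) := FiniteDimensional.complete ℂ _
  exact ((spectrum.spectralRadius_le_nnnorm A).trans_lt ENNReal.coe_lt_top).ne

end Norm

theorem spectralRadius_le_of_entrywise_le_hadamardWeightedMean [DecidableEq ι] [Nonempty ι]
    (h0 : ∀ j, 0 ≤ α j) (h1 : ∑ j, α j = 1) {P : Matrix ι ι ℝ≥0} {A : κ → Matrix ι ι ℝ≥0}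
    (hP : ∀ x y, P x y ≤ hadamardWeightedMean α A x y) :
    spectralRadius ℂ (nnrealToComplex P) ≤
      ∏ j, spectralRadius ℂ (nnrealToComplex (A j)) ^ α j := by
  have hlim := ENNReal.tendsto_finsetProd_of_ne_top Finset.univ
    (fun j _ => (tendsto_maxRowSum_pow (A j)).ennrpow_const (α j))
    (fun j _ => ENNReal.rpow_ne_top_of_nonneg (h0 j) (spectralRadius_ne_top _))
  refine le_of_tendsto_of_tendsto' (tendsto_maxRowSum_pow P) hlim fun N => ?_
  have hN : maxRowSum (P ^ N) ≤ ∏ j, maxRowSum (A j ^ N) ^ α j :=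
    (maxRowSum_mono fun x y => (pow_entrywise_le_pow hP N x y).trans
      (hadamardWeightedMean_pow_le h0 h1 A N x y)).trans
      (maxRowSum_hadamardWeightedMean_le h0 h1 _)
  calc (maxRowSum (P ^ N) : ℝ≥0∞) ^ (1 / N : ℝ)
      ≤ ((∏ j, maxRowSum (A j ^ N) ^ α j : ℝ≥0) : ℝ≥0∞) ^ (1 / N : ℝ) :=
        ENNReal.rpow_le_rpow (ENNReal.coe_le_coe.2 hN) (by positivity)
    _ = ∏ j, ((maxRowSum (A j ^ N) : ℝ≥0∞) ^ (1 / N : ℝ)) ^ α j := by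
        rw [ENNReal.ofNNReal_finsetProd, ← ENNReal.prod_rpow_of_nonneg (by positivity)]
        refine Finset.prod_congr rfl fun j _ => ?_
        rw [ENNReal.coe_rpow_of_nonneg _ (h0 j), ← ENNReal.rpow_mul, ← ENNReal.rpow_mul,
          mul_comm]

end NNRealMatrix

end Matrix

theorem specRad_map_coe {n : ℕ} (A : Matrix (Fin n) (Fin n) ℝ≥0) :
    specRad (NNReal.toRealHom.mapMatrix A) = spectralRadius ℂ A.nnrealToComplex :=
  rfl

theorem matListProd_map_coe {n k : ℕ} (A : Fin k → Matrix (Fin n) (Fin n) ℝ≥0) :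
    matListProd (fun i => NNReal.toRealHom.mapMatrix (A i)) =
      NNReal.toRealHom.mapMatrix (List.ofFn A).prod := by
  rw [matListProd, map_list_prod, List.map_ofFn]
  rfl

theorem hadWMean_map_coe {n m : ℕ} (α : Fin m → ℝ)
    (A : Fin m → Matrix (Fin n) (Fin n) ℝ≥0) :
    hadWMean α (fun j => NNReal.toRealHom.mapMatrix (A j)) =
      NNReal.toRealHom.mapMatrix (Matrix.hadamardWeightedMean α A) := by
  ext x y
  simp [hadWMean, Matrix.hadamardWeightedMean]

/-- Theorem 2.1, inequality (6): spectral-radius inequality for the product of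
weighted Hadamard geometric means of non-negative matrices. -/
theorem hadamard_mean_prod_specRad_le {k m n : ℕ} (hk : 0 < k) (hm : 0 < m)
    (hn : 0 < n) (A : Fin k → Fin m → Matrix (Fin n) (Fin n) ℝ)
    (hA : ∀ i j x y, 0 ≤ A i j x y)
    (α : Fin m → ℝ) (hα : ∀ j, 0 < α j) (hαsum : ∑ j, α j = 1) :
    specRad (matListProd (fun i => hadWMean α (A i))) ≤
      ∏ j, specRad (matListProd (fun i => A i j)) ^ (α j) := by
  have : Nonempty (Fin n) := ⟨⟨0, hn⟩⟩
  obtain ⟨B, rfl⟩ : ∃ B : Fin k → Fin m → Matrix (Fin n) (Fin n) ℝ≥0,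
      A = fun i j => NNReal.toRealHom.mapMatrix (B i j) :=
    ⟨fun i j => Matrix.of fun x y => ⟨A i j x y, hA i j x y⟩, rfl⟩
  simp only [hadWMean_map_coe, matListProd_map_coe, specRad_map_coe]
  refine Matrix.spectralRadius_le_of_entrywise_le_hadamardWeightedMean
    (fun j => (hα j).le) hαsum fun x y => ?_
  simpa [List.map_ofFn, Function.comp_def] using
    Matrix.list_prod_hadamardWeightedMean_le (fun j => (hα j).le) hαsum (List.ofFn B) x y
end

section
/- Let m, n be positive integers, let A₁,...,Aₘ be n×n matrices with nonnegative real entries, and let α₁,...,αₘ be positive real numbers with α₁ + ⋯ + αₘ ≥ 1. Then ‖A₁^(α₁) ∘ ⋯ ∘ Aₘ^(αₘ)‖ ≤ ‖A₁‖^{α₁} ⋯ ‖Aₘ‖^{αₘ} and ρ(A₁^(α₁) ∘ ⋯ ∘ Aₘ^(αₘ)) ≤ ρ(A₁)^{α₁} ⋯ ρ(Aₘ)^{αₘ}. -/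
open scoped ENNReal NNReal BigOperators

/-- A product of weighted powers of numbers `t j ≤ a j` whose exponents sum to at least one is at
most the product of the powers of the `a j`, times a convex combination of the ratios `t j / a j`. -/
lemma prod_rpow_le_prod_rpow_mul_sum {κ : Type*} [Fintype κ] {α t a : κ → ℝ} (hα : ∀ j, 0 < α j)
    (hαsum : 1 ≤ ∑ j, α j) (ht : ∀ j, 0 ≤ t j) (hta : ∀ j, t j ≤ a j) (ha : ∀ j, 0 < a j) :
    ∏ j, t j ^ α j ≤ (∏ j, a j ^ α j) * ∑ j, (α j / ∑ i, α i) / a j * t j := by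
  have hs : 0 < ∑ i, α i := one_pos.trans_le hαsum
  have hr : ∀ j, 0 ≤ t j / a j := fun j => div_nonneg (ht j) (ha j).le
  calc ∏ j, t j ^ α j = (∏ j, a j ^ α j) * ∏ j, (t j / a j) ^ α j := by
        rw [← Finset.prod_mul_distrib]
        refine Finset.prod_congr rfl fun j _ => ?_
        rw [← Real.mul_rpow (ha j).le (hr j), mul_div_cancel₀ _ (ha j).ne']
    _ ≤ (∏ j, a j ^ α j) * ∏ j, (t j / a j) ^ (α j / ∑ i, α i) := by
        refine mul_le_mul_of_nonneg_left (Finset.prod_le_prod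
          (fun j _ => Real.rpow_nonneg (hr j) _) fun j _ => ?_)
          (Finset.prod_nonneg fun j _ => Real.rpow_nonneg (ha j).le _)
        exact Real.rpow_le_rpow_of_exponent_ge_of_imp (hr j) ((div_le_one (ha j)).2 (hta j))
          (div_le_self (hα j).le hαsum) fun _ h => absurd h (hα j).ne'
    _ ≤ (∏ j, a j ^ α j) * ∑ j, (α j / ∑ i, α i) * (t j / a j) := by
        refine mul_le_mul_of_nonneg_left ?_
          (Finset.prod_nonneg fun j _ => Real.rpow_nonneg (ha j).le _)
        exact Real.geom_mean_le_arith_mean_weighted _ _ _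
          (fun j _ => div_nonneg (hα j).le hs.le)
          (by rw [← Finset.sum_div, div_self hs.ne']) fun j _ => hr j
    _ = _ := by
        congr 1
        exact Finset.sum_congr rfl fun j _ => by ring

/-- Weighted Hölder inequality for seminorms on `ι → ℝ` that are monotone on nonnegative functions
and dominate the values of nonnegative functions. -/
lemma Seminorm.prod_rpow_le {ι κ : Type*} [Fintype κ] (N : Seminorm ℝ (ι → ℝ))
    (hmono : ∀ f g : ι → ℝ, 0 ≤ f → f ≤ g → N f ≤ N g) (hle : ∀ f : ι → ℝ, 0 ≤ f → ∀ i, f i ≤ N f)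
    {α : κ → ℝ} (hα : ∀ j, 0 < α j) (hαsum : 1 ≤ ∑ j, α j) {f : κ → ι → ℝ} (hf : ∀ j, 0 ≤ f j) :
    N (fun i => ∏ j, f j i ^ α j) ≤ ∏ j, N (f j) ^ α j := by
  by_cases h : ∃ j, N (f j) = 0
  · obtain ⟨j, hj⟩ := h
    have h0 : (fun i => ∏ j, f j i ^ α j) = 0 := by
      funext i
      have hji : f j i = 0 := le_antisymm (hj ▸ hle _ (hf j) i) (hf j i)
      exact Finset.prod_eq_zero (Finset.mem_univ j) (by rw [hji, Real.zero_rpow (hα j).ne'])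
    rw [h0, map_zero]
    exact Finset.prod_nonneg fun j _ => Real.rpow_nonneg (apply_nonneg N _) _
  push Not at h
  have ha : ∀ j, 0 < N (f j) := fun j => (apply_nonneg N _).lt_of_ne' (h j)
  have hs : 0 < ∑ i, α i := one_pos.trans_le hαsum
  have hP : 0 ≤ ∏ j, N (f j) ^ α j := Finset.prod_nonneg fun j _ => Real.rpow_nonneg (ha j).le _
  calc N (fun i => ∏ j, f j i ^ α j)
      ≤ N ((∏ j, N (f j) ^ α j) • ∑ j, ((α j / ∑ i, α i) / N (f j)) • f j) := by
        refine hmono _ _ (fun i => Finset.prod_nonneg fun j _ => Real.rpow_nonneg (hf j i) _)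
          fun i => ?_
        simpa using prod_rpow_le_prod_rpow_mul_sum hα hαsum (fun j => hf j i)
          (fun j => hle _ (hf j) i) ha
    _ ≤ (∏ j, N (f j) ^ α j) * ∑ j, N (((α j / ∑ i, α i) / N (f j)) • f j) := by
        rw [map_smul_eq_mul, Real.norm_of_nonneg hP]
        exact mul_le_mul_of_nonneg_left
          (Finset.le_sum_of_subadditive N (map_zero N).le (map_add_le_add N) _ _) hP
    _ = (∏ j, N (f j) ^ α j) * ∑ j, α j / ∑ i, α i := by
        congr 1
        refine Finset.sum_congr rfl fun j _ => ?_
        rw [map_smul_eq_mul, Real.norm_of_nonneg (div_nonneg (div_nonneg (hα j).le hs.le) (ha j).le),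
          div_mul_cancel₀ _ (h j)]
    _ = ∏ j, N (f j) ^ α j := by rw [← Finset.sum_div, div_self hs.ne', mul_one]

/-- Weighted Hölder inequality for finite sums, with exponents summing to at least one. -/
lemma sum_prod_rpow_le_prod_sum_rpow {ι κ : Type*} [Fintype ι] [Fintype κ] {α : κ → ℝ}
    (hα : ∀ j, 0 < α j) (hαsum : 1 ≤ ∑ j, α j) {f : κ → ι → ℝ} (hf : ∀ j i, 0 ≤ f j i) :
    ∑ i, ∏ j, f j i ^ α j ≤ ∏ j, (∑ i, f j i) ^ α j := by
  let N : Seminorm ℝ (ι → ℝ) := .of (fun g => ∑ i, |g i|)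
    (fun g h => by
      rw [← Finset.sum_add_distrib]
      exact Finset.sum_le_sum fun i _ => abs_add_le _ _)
    fun c g => by simp [abs_mul, Finset.mul_sum]
  have hN : ∀ g : ι → ℝ, 0 ≤ g → N g = ∑ i, g i := fun g hg =>
    Finset.sum_congr rfl fun i _ => abs_of_nonneg (hg i)
  have key := N.prod_rpow_le (f := f)
    (fun g h hg hgh => by
      rw [hN g hg, hN h (hg.trans hgh)]
      exact Finset.sum_le_sum fun i _ => hgh i)
    (fun g hg i => by
      rw [hN g hg]
      exact Finset.single_le_sum (fun i _ => hg i) (Finset.mem_univ i))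
    hα hαsum hf
  rw [hN _ fun i => Finset.prod_nonneg fun j _ => Real.rpow_nonneg (hf j i) _] at key
  simpa only [hN _ (hf _)] using key

lemma opNorm_mono {n : ℕ} {A B : Matrix (Fin n) (Fin n) ℝ} (hA : ∀ x y, 0 ≤ A x y)
    (hAB : ∀ x y, A x y ≤ B x y) : opNorm A ≤ opNorm B := by
  refine ContinuousLinearMap.opNorm_le_bound _ (norm_nonneg _) fun v => ?_
  let w : EuclideanSpace ℝ (Fin n) := WithLp.toLp 2 fun i => |v i|
  have hw : ‖w‖ = ‖v‖ := by simp [EuclideanSpace.norm_eq, w]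
  rw [← hw]
  refine le_trans ?_ (ContinuousLinearMap.le_opNorm _ w)
  rw [EuclideanSpace.norm_eq, EuclideanSpace.norm_eq]
  refine Real.sqrt_le_sqrt (Finset.sum_le_sum fun x _ => pow_le_pow_left₀ (norm_nonneg _) ?_ 2)
  simp only [LinearMap.coe_toContinuousLinearMap', Matrix.toLpLin_apply, Matrix.mulVec,
    dotProduct, Real.norm_eq_abs, w]
  refine (Finset.abs_sum_le_sum_abs _ _).trans (le_trans ?_ (le_abs_self _))
  refine Finset.sum_le_sum fun y _ => ?_
  rw [abs_mul, abs_of_nonneg (hA x y)]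
  exact mul_le_mul_of_nonneg_right (hAB x y) (abs_nonneg _)

lemma apply_le_opNorm {n : ℕ} (A : Matrix (Fin n) (Fin n) ℝ) (x y : Fin n) : A x y ≤ opNorm A := by
  have h := ContinuousLinearMap.le_opNorm (LinearMap.toContinuousLinearMap (Matrix.toEuclideanLin A))
    (EuclideanSpace.single y 1)
  have hx := PiLp.norm_apply_le (Matrix.toEuclideanLin A (EuclideanSpace.single y 1)) x
  simp only [LinearMap.coe_toContinuousLinearMap', PiLp.norm_single, norm_one,
    mul_one] at h
  refine (le_abs_self _).trans (le_trans (le_of_eq ?_) (hx.trans h))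
  simp [Matrix.toLpLin_apply]

lemma opNorm_hadWMean_le {m n : ℕ} {A : Fin m → Matrix (Fin n) (Fin n) ℝ}
    (hA : ∀ j x y, 0 ≤ A j x y) {α : Fin m → ℝ} (hα : ∀ j, 0 < α j) (hαsum : 1 ≤ ∑ j, α j) :
    opNorm (hadWMean α A) ≤ ∏ j, opNorm (A j) ^ α j := by
  let N : Seminorm ℝ (Fin n × Fin n → ℝ) :=
    .of (fun f => opNorm (Matrix.of fun x y => f (x, y)))
    (fun f g => by
      unfold opNorm
      refine le_trans (le_of_eq ?_) (norm_add_le _ _)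
      rw [← map_add, ← map_add]
      rfl)
    fun c f => by
      unfold opNorm
      rw [← norm_smul, ← map_smul, ← map_smul]
      rfl
  exact N.prod_rpow_le (f := fun j p => A j p.1 p.2)
    (fun f g hf hfg => opNorm_mono (fun x y => hf (x, y)) fun x y => hfg (x, y))
    (fun f _ p => apply_le_opNorm (Matrix.of fun x y => f (x, y)) p.1 p.2)
    hα hαsum fun j p => hA j p.1 p.2

lemma hadWMean_nonneg {m n : ℕ} {A : Fin m → Matrix (Fin n) (Fin n) ℝ}
    (hA : ∀ j x y, 0 ≤ A j x y) (α : Fin m → ℝ) (x y : Fin n) : 0 ≤ hadWMean α A x y := by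
  simp only [hadWMean, Matrix.of_apply]
  exact Finset.prod_nonneg fun j _ => Real.rpow_nonneg (hA j x y) _

/-- Powers of a weighted Hadamard mean are dominated by the mean of the powers. -/
lemma hadWMean_pow_apply_le {m n : ℕ} {A : Fin m → Matrix (Fin n) (Fin n) ℝ}
    (hA : ∀ j x y, 0 ≤ A j x y) {α : Fin m → ℝ} (hα : ∀ j, 0 < α j) (hαsum : 1 ≤ ∑ j, α j)
    (k : ℕ) (x y : Fin n) :
    (hadWMean α A ^ k) x y ≤ hadWMean α (fun j => A j ^ k) x y := by
  induction k generalizing y with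
  | zero =>
    by_cases hxy : x = y
    · simp [hadWMean, hxy]
    · rw [pow_zero, Matrix.one_apply_ne hxy]
      exact hadWMean_nonneg (fun j => Matrix.pow_apply_nonneg (hA j) 0) α x y
  | succ k ih =>
    rw [pow_succ, Matrix.mul_apply]
    calc ∑ z, (hadWMean α A ^ k) x z * hadWMean α A z y
        ≤ ∑ z, ∏ j, ((A j ^ k) x z * A j z y) ^ α j := by
          refine Finset.sum_le_sum fun z _ => ?_
          refine (mul_le_mul_of_nonneg_right (ih z) (hadWMean_nonneg hA α z y)).trans_eq ?_
          simp only [hadWMean, Matrix.of_apply, ← Finset.prod_mul_distrib]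
          exact Finset.prod_congr rfl fun j _ =>
            (Real.mul_rpow (Matrix.pow_apply_nonneg (hA j) k x z) (hA j z y)).symm
      _ ≤ ∏ j, (∑ z, (A j ^ k) x z * A j z y) ^ α j :=
          sum_prod_rpow_le_prod_sum_rpow hα hαsum fun j z =>
            mul_nonneg (Matrix.pow_apply_nonneg (hA j) k x z) (hA j z y)
      _ = hadWMean α (fun j => A j ^ (k + 1)) x y := by
          simp only [hadWMean, Matrix.of_apply, pow_succ, Matrix.mul_apply]

section RowSumNorm

attribute [local instance] Matrix.linftyOpNormedRing Matrix.linftyOpNormedAlgebra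

lemma sum_le_norm_map_ofReal {n : ℕ} (A : Matrix (Fin n) (Fin n) ℝ) (x : Fin n) :
    ∑ y, A x y ≤ ‖A.map (fun x => (x : ℂ))‖ := by
  rw [Matrix.linfty_opNorm_def]
  have h := Finset.le_sup (f := fun i => ∑ j, ‖(A.map (fun x => (x : ℂ))) i j‖₊)
    (Finset.mem_univ x)
  refine le_trans ?_ (NNReal.coe_le_coe.2 h)
  push_cast
  refine Finset.sum_le_sum fun y _ => ?_
  simpa using le_abs_self (A x y)

lemma norm_map_ofReal_le {n : ℕ} {A : Matrix (Fin n) (Fin n) ℝ} (hA : ∀ x y, 0 ≤ A x y) {c : ℝ}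
    (hc : 0 ≤ c) (h : ∀ x, ∑ y, A x y ≤ c) : ‖A.map (fun x => (x : ℂ))‖ ≤ c := by
  rw [Matrix.linfty_opNorm_def]
  lift c to NNReal using hc
  refine NNReal.coe_le_coe.2 (Finset.sup_le fun x _ => NNReal.coe_le_coe.1 ?_)
  push_cast
  refine le_trans (Finset.sum_le_sum fun y _ => ?_) (h x)
  simp [abs_of_nonneg (hA x y)]

lemma norm_map_ofReal_hadWMean_pow_le {m n : ℕ} {A : Fin m → Matrix (Fin n) (Fin n) ℝ}
    (hA : ∀ j x y, 0 ≤ A j x y) {α : Fin m → ℝ} (hα : ∀ j, 0 < α j) (hαsum : 1 ≤ ∑ j, α j)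
    (k : ℕ) :
    ‖(hadWMean α A ^ k).map (fun x => (x : ℂ))‖ ≤
      ∏ j, ‖(A j ^ k).map (fun x => (x : ℂ))‖ ^ α j := by
  have hk := fun j => Matrix.pow_apply_nonneg (hA j) k
  refine norm_map_ofReal_le (Matrix.pow_apply_nonneg (hadWMean_nonneg hA α) k)
    (Finset.prod_nonneg fun j _ => Real.rpow_nonneg (norm_nonneg _) _) fun x => ?_
  calc ∑ y, (hadWMean α A ^ k) x y ≤ ∑ y, ∏ j, (A j ^ k) x y ^ α j :=
        Finset.sum_le_sum fun y _ => hadWMean_pow_apply_le hA hα hαsum k x y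
    _ ≤ ∏ j, (∑ y, (A j ^ k) x y) ^ α j :=
        sum_prod_rpow_le_prod_sum_rpow hα hαsum fun j y => hk j x y
    _ ≤ _ := Finset.prod_le_prod
        (fun j _ => Real.rpow_nonneg (Finset.sum_nonneg fun y _ => hk j x y) _)
        fun j _ => Real.rpow_le_rpow (Finset.sum_nonneg fun y _ => hk j x y)
          (sum_le_norm_map_ofReal _ x) (hα j).le

lemma tendsto_norm_map_pow_specRad {n : ℕ} (A : Matrix (Fin n) (Fin n) ℝ) :
    Filter.Tendsto (fun k : ℕ => ENNReal.ofReal (‖(A ^ k).map (fun x => (x : ℂ))‖ ^ (1 / k : ℝ)))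
      Filter.atTop (nhds (specRad A)) := by
  have h := spectrum.pow_norm_pow_one_div_tendsto_nhds_spectralRadius (A.map (fun x => (x : ℂ)))
  refine h.congr fun k => ?_
  rw [← show (A ^ k).map (fun x => (x : ℂ)) = A.map (fun x => (x : ℂ)) ^ k from
    Matrix.map_pow A Complex.ofRealHom k]

lemma specRad_ne_top {n : ℕ} (A : Matrix (Fin n) (Fin n) ℝ) : specRad A ≠ ∞ := by
  refine ne_top_of_le_ne_top ?_
    (spectrum.spectralRadius_le_pow_nnnorm_pow_one_div ℂ (A.map (fun x => (x : ℂ))) 0)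
  finiteness

lemma specRad_hadWMean_le {m n : ℕ} {A : Fin m → Matrix (Fin n) (Fin n) ℝ}
    (hA : ∀ j x y, 0 ≤ A j x y) {α : Fin m → ℝ} (hα : ∀ j, 0 < α j) (hαsum : 1 ≤ ∑ j, α j) :
    specRad (hadWMean α A) ≤ ∏ j, specRad (A j) ^ α j := by
  have hlim : Filter.Tendsto (fun k : ℕ => ∏ j,
      ENNReal.ofReal (‖(A j ^ k).map (fun x => (x : ℂ))‖ ^ (1 / k : ℝ)) ^ α j)
      Filter.atTop (nhds (∏ j, specRad (A j) ^ α j)) :=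
    ENNReal.tendsto_finsetProd_of_ne_top _
      (fun j _ => (ENNReal.continuous_rpow_const.tendsto _).comp
        (tendsto_norm_map_pow_specRad (A j)))
      fun j _ => ENNReal.rpow_ne_top_of_nonneg (hα j).le (specRad_ne_top _)
  refine le_of_tendsto_of_tendsto' (tendsto_norm_map_pow_specRad _) hlim fun k => ?_
  have hnn : ∀ j, 0 ≤ ‖(A j ^ k).map (fun x => (x : ℂ))‖ ^ α j :=
    fun j => Real.rpow_nonneg (norm_nonneg _) _
  calc _ ≤ ENNReal.ofReal ((∏ j, ‖(A j ^ k).map (fun x => (x : ℂ))‖ ^ α j) ^ (1 / k : ℝ)) :=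
        ENNReal.ofReal_le_ofReal (Real.rpow_le_rpow (norm_nonneg _)
          (norm_map_ofReal_hadWMean_pow_le hA hα hαsum k) (by positivity))
    _ = _ := by
        rw [← Real.finsetProd_rpow _ _ fun j _ => hnn j,
          ENNReal.ofReal_prod_of_nonneg fun j _ => Real.rpow_nonneg (hnn j) _]
        refine Finset.prod_congr rfl fun j _ => ?_
        rw [ENNReal.ofReal_rpow_of_nonneg (by positivity) (hα j).le, ← Real.rpow_mul (by positivity),
          ← Real.rpow_mul (by positivity), mul_comm]

end RowSumNorm

/-- Norm and spectral-radius inequalities for a weighted Hadamard geometric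
mean of non-negative matrices, under the weaker assumption `α₁ + ⋯ + αₘ ≥ 1`. -/
theorem hadamard_mean_opNorm_specRad_le_of_one_le_sum {m n : ℕ} (hm : 0 < m)
    (hn : 0 < n) (A : Fin m → Matrix (Fin n) (Fin n) ℝ)
    (hA : ∀ j x y, 0 ≤ A j x y)
    (α : Fin m → ℝ) (hα : ∀ j, 0 < α j) (hαsum : 1 ≤ ∑ j, α j) :
    opNorm (hadWMean α A) ≤ ∏ j, opNorm (A j) ^ (α j) ∧
      specRad (hadWMean α A) ≤ ∏ j, specRad (A j) ^ (α j) := by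
  exact ⟨opNorm_hadWMean_le hA hα hαsum, specRad_hadWMean_le hA hα hαsum⟩
end
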